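/- If X is a nonempty separable metric space, then dim_tH (X × [0,1]) = dim_H X + 1, where X × [0,1] carries the metric d((x₁,t₁),(x₂,t₂)) = √(d_X(x₁,x₂)² + |t₁−t₂|²). -/

import Mathlib

open MeasureTheory Topology Metric Set
open scoped Classical

/-- Hausdorff dimension of a subset of a metric space, as an extended real number, with the
convention that the empty set has dimension `-1`. -/
noncomputable def hdim {X : Type*} [EMetricSpace X] (s : Set X) : EReal :=
  if s = ∅ then -1 else (dimH s : EReal)

/-- The topological Hausdorff dimension of a metric space `X`:
`dim_tH X = inf {d : X has a basis 𝒰 such that dim_H ∂U ≤ d − 1 for every U ∈ 𝒰}`, with the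
convention `dim_tH ∅ = -1` (the infimum of the empty set of extended reals being `⊤`). -/
noncomputable def tHdim (X : Type*) [MetricSpace X] : EReal :=
  if Nonempty X then
    sInf {d : EReal | ∃ 𝒰 : Set (Set X), TopologicalSpace.IsTopologicalBasis 𝒰 ∧
      ∀ U ∈ 𝒰, hdim (frontier U) ≤ d - 1}
  else -1

section HausdorffNull

open Filter
open scoped ENNReal NNReal

/-- A set that is null for the `s`-dimensional Hausdorff measure has countable covers with
arbitrarily small `s`-dimensional content. -/
theorem exists_cover_tsum_ediam_rpow_le {Z : Type*} [EMetricSpace Z] [MeasurableSpace Z]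
    [BorelSpace Z] {s : ℝ} (hs : 0 < s) {A : Set Z} (hA : μH[s] A = 0) {ε : ℝ≥0∞} (hε : 0 < ε) :
    ∃ t : ℕ → Set Z, A ⊆ ⋃ i, t i ∧ ∑' i, ediam (t i) ^ s ≤ ε := by
  have h : (⨅ (t : ℕ → Set Z) (_ : A ⊆ ⋃ n, t n) (_ : ∀ n, ediam (t n) ≤ 1),
      ∑' n, ⨆ _ : (t n).Nonempty, ediam (t n) ^ s) < ε := by
    refine lt_of_le_of_lt ?_ hε
    rw [← hA, Measure.hausdorffMeasure_apply]
    exact le_iSup₂_of_le (1 : ℝ≥0∞) one_pos le_rfl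
  simp only [iInf_lt_iff] at h
  obtain ⟨t, hAt, -, ht⟩ := h
  refine ⟨t, hAt, le_trans (ENNReal.tsum_le_tsum fun i => ?_) ht.le⟩
  rcases (t i).eq_empty_or_nonempty with hi | hi
  · simp [hi, ENNReal.zero_rpow_of_pos hs]
  · simp [hi]

theorem ediam_le_rpow_inv_of_tsum_le {Z ι : Type*} [EMetricSpace Z] {s : ℝ} (hs : 0 < s)
    {t : ι → Set Z} {ε : ℝ≥0∞} (h : ∑' i, ediam (t i) ^ s ≤ ε) (i : ι) :
    ediam (t i) ≤ ε ^ s⁻¹ := by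
  rw [ENNReal.le_rpow_inv_iff hs]
  exact (ENNReal.le_tsum i).trans h

theorem tendsto_rpow_inv_nhds_zero {s : ℝ} (hs : 0 < s) {c : ℕ → ℝ≥0∞}
    (hc : Tendsto c atTop (𝓝 0)) : Tendsto (fun n => c n ^ s⁻¹) atTop (𝓝 0) := by
  have h := ((ENNReal.continuous_rpow_const (y := s⁻¹)).tendsto 0).comp hc
  rwa [ENNReal.zero_rpow_of_pos (inv_pos.2 hs)] at h

/-- A set having countable covers with arbitrarily small `s`-dimensional content is null for the
`s`-dimensional Hausdorff measure. -/
theorem hausdorffMeasure_eq_zero_of_covers {Z : Type*} [EMetricSpace Z] [MeasurableSpace Z]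
    [BorelSpace Z] {s : ℝ} (hs : 0 < s) {A : Set Z}
    (h : ∀ ε : ℝ≥0∞, 0 < ε → ∃ (ι : Type) (_ : Countable ι) (t : ι → Set Z),
      A ⊆ ⋃ i, t i ∧ ∑' i, ediam (t i) ^ s ≤ ε) : μH[s] A = 0 := by
  have hc : Tendsto (fun n : ℕ => ((n : ℝ≥0∞))⁻¹) atTop (𝓝 0) :=
    ENNReal.tendsto_inv_nat_nhds_zero
  choose ι hι t hAt ht using fun n : ℕ =>
    h ((n : ℝ≥0∞))⁻¹ (ENNReal.inv_pos.2 (ENNReal.natCast_ne_top n))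
  have key := Measure.hausdorffMeasure_le_liminf_tsum s A _ (tendsto_rpow_inv_nhds_zero hs hc) t
    (.of_forall fun n => ediam_le_rpow_inv_of_tsum_le hs (ht n)) (.of_forall hAt)
  refine le_antisymm (key.trans ?_) zero_le
  rw [← hc.liminf_eq]
  exact liminf_le_liminf (.of_forall ht)

/-- Eilenberg's inequality in the null case: almost every level set of a Lipschitz function
on an `(s + 1)`-null space is `s`-null. -/
theorem ae_hausdorffMeasure_preimage_singleton_eq_zero {Z : Type*} [EMetricSpace Z]
    [MeasurableSpace Z] [BorelSpace Z] {s : ℝ} (hs : 0 < s) (hZ : μH[s + 1] (univ : Set Z) = 0)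
    {f : Z → ℝ} (hf : LipschitzWith 1 f) : ∀ᵐ r : ℝ, μH[s] (f ⁻¹' {r}) = 0 := by
  have hs1 : 0 < s + 1 := by linarith
  have hc : Tendsto (fun n : ℕ => ((n : ℝ≥0∞))⁻¹) atTop (𝓝 0) :=
    ENNReal.tendsto_inv_nat_nhds_zero
  choose t hZt ht using fun n : ℕ => exists_cover_tsum_ediam_rpow_le hs1 hZ
    (ENNReal.inv_pos.2 (ENNReal.natCast_ne_top n))
  let g : ℕ → ℝ → ℝ≥0∞ := fun n r =>
    ∑' i, (closure (f '' t n i)).indicator (fun _ => ediam (t n i) ^ s) r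
  have hmeas : ∀ n i, Measurable
      ((closure (f '' t n i)).indicator fun _ : ℝ => ediam (t n i) ^ s) :=
    fun n i => measurable_const.indicator isClosed_closure.measurableSet
  have hg : ∀ n, Measurable (g n) := fun n => Measurable.tsum (hmeas n)
  have hint : ∀ n, ∫⁻ r, g n r ≤ ((n : ℝ≥0∞))⁻¹ := by
    intro n
    rw [lintegral_tsum fun i => (hmeas n i).aemeasurable]
    refine (ENNReal.tsum_le_tsum fun i => ?_).trans (ht n)
    rw [lintegral_indicator_const isClosed_closure.measurableSet,
      ENNReal.rpow_add_of_nonneg _ _ hs.le zero_le_one, ENNReal.rpow_one]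
    gcongr
    calc volume (closure (f '' t n i)) ≤ ediam (closure (f '' t n i)) := Real.volume_le_diam _
      _ ≤ ediam (t n i) := by
        rw [Metric.ediam_closure]
        simpa using hf.ediam_image_le (t n i)
  have hlim : ∀ᵐ r : ℝ, liminf (fun n => g n r) atTop = 0 := by
    refine (lintegral_eq_zero_iff (Measurable.liminf hg)).1 (le_antisymm ?_ zero_le)
    refine (lintegral_liminf_le hg).trans ?_
    rw [← hc.liminf_eq]
    exact liminf_le_liminf (.of_forall hint)
  filter_upwards [hlim] with r hr
  have key := Measure.hausdorffMeasure_le_liminf_tsum s (f ⁻¹' {r}) _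
    (tendsto_rpow_inv_nhds_zero hs1 hc) (fun n i => t n i ∩ f ⁻¹' {r})
    (.of_forall fun n i => (ediam_mono inter_subset_left).trans
      (ediam_le_rpow_inv_of_tsum_le hs1 (ht n) i))
    (.of_forall fun n z hz => by
      obtain ⟨i, hi⟩ := mem_iUnion.1 (hZt n (mem_univ z))
      exact mem_iUnion.2 ⟨i, hi, hz⟩)
  refine le_antisymm (key.trans ?_) zero_le
  rw [← hr]
  refine liminf_le_liminf (.of_forall fun n => ENNReal.tsum_le_tsum fun i => ?_)
  rcases (t n i ∩ f ⁻¹' {r}).eq_empty_or_nonempty with hi | ⟨z, hz, hzr⟩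
  · simp [hi, ENNReal.zero_rpow_of_pos hs]
  · rw [indicator_of_mem (subset_closure (show r ∈ f '' t n i from ⟨z, hz, hzr⟩))]
    exact ENNReal.rpow_le_rpow (ediam_mono inter_subset_left) hs.le

theorem exists_nat_inv_le_mul_le_two {a : ℝ} (ha : 0 < a) (ha1 : a ≤ 1) :
    ∃ N : ℕ, 0 < N ∧ (N : ℝ)⁻¹ ≤ a ∧ N * a ≤ 2 := by
  refine ⟨⌈a⁻¹⌉₊, Nat.ceil_pos.2 (inv_pos.2 ha), ?_, ?_⟩
  · exact inv_le_of_inv_le₀ ha (Nat.le_ceil _)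
  · have h := Nat.ceil_lt_add_one (inv_pos.2 ha).le
    calc (⌈a⁻¹⌉₊ : ℝ) * a ≤ (a⁻¹ + 1) * a := by gcongr
      _ = 1 + a := by field_simp
      _ ≤ 2 := by linarith

/-- A set of diameter at most `a ≤ 1`, multiplied by the unit interval, is covered by finitely
many sets of diameter at most `a`, their number `N` satisfying `N * a ≤ 2`. -/
theorem exists_cover_prod_unitInterval {X : Type*} [MetricSpace X] {A : Set X} {a : ℝ≥0}
    (ha : 0 < a) (ha1 : a ≤ 1) (hA : ediam A ≤ a) :
    ∃ (N : ℕ) (u : Fin N → Set (X × ↥(Set.Icc (0 : ℝ) 1))), A ×ˢ univ ⊆ ⋃ k, u k ∧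
      (∀ k, ediam (u k) ≤ a) ∧ (N : ℝ≥0∞) * a ≤ 2 := by
  obtain ⟨N, hN, hNa, hN2⟩ := exists_nat_inv_le_mul_le_two (a := a) (by exact_mod_cast ha)
    (by exact_mod_cast ha1)
  have hN' : (0 : ℝ) < N := by exact_mod_cast hN
  refine ⟨N, fun k => A ×ˢ {x : ↥(Set.Icc (0 : ℝ) 1) | (x : ℝ) ∈ Icc ((k : ℝ) / N) ((k + 1 : ℝ) / N)}, ?_, ?_, ?_⟩
  · rintro ⟨x, y, hy0, hy1⟩ ⟨hx, -⟩
    have hfl := Nat.floor_le (a := y * N) (by positivity)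
    have hlt := Nat.lt_floor_add_one (y * N)
    by_cases h : ⌊y * N⌋₊ < N
    · refine mem_iUnion.2 ⟨⟨⌊y * N⌋₊, h⟩, hx, ?_, ?_⟩
      · exact (div_le_iff₀ hN').2 hfl
      · exact (le_div_iff₀ hN').2 hlt.le
    · have hy : y = 1 := by
        have h1 : (N : ℝ) ≤ ⌊y * N⌋₊ := by exact_mod_cast not_lt.1 h
        nlinarith
      refine mem_iUnion.2 ⟨⟨N - 1, by omega⟩, hx, ?_, ?_⟩
      · refine (div_le_iff₀ hN').2 ?_
        simp [hy]
      · refine (le_div_iff₀ hN').2 ?_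
        have : ((N - 1 : ℕ) : ℝ) + 1 = N := by exact_mod_cast Nat.sub_add_cancel hN
        simp [hy, this]
  · refine fun k => ediam_le ?_
    rintro ⟨x, y⟩ ⟨hx, hy⟩ ⟨x', y'⟩ ⟨hx', hy'⟩
    rw [Prod.edist_eq]
    refine max_le ((edist_le_ediam_of_mem hx hx').trans hA) ?_
    rw [edist_nndist, ENNReal.coe_le_coe, ← NNReal.coe_le_coe, coe_nndist]
    refine le_trans (Real.dist_le_of_mem_Icc hy hy') (le_trans (le_of_eq ?_) hNa)
    field_simp
    ring
  · have : (N : ℝ≥0) * a ≤ 2 := by exact_mod_cast hN2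
    exact_mod_cast this

theorem hausdorffMeasure_prod_unitInterval_eq_zero {X : Type*} [MetricSpace X] [MeasurableSpace X]
    [BorelSpace X] [SecondCountableTopology X] {s : ℝ} (hs : 0 < s)
    (hX : μH[s] (univ : Set X) = 0) :
    μH[s + 1] (univ : Set (X × ↥(Set.Icc (0 : ℝ) 1))) = 0 := by
  refine hausdorffMeasure_eq_zero_of_covers (by linarith) fun ε hε => ?_
  let δ : ℝ≥0∞ := min (ε / 4) (1 / 2)
  have hδ : 0 < δ := lt_min (ENNReal.div_pos hε.ne' (by simp)) (by simp)
  obtain ⟨t, hXt, ht⟩ := exists_cover_tsum_ediam_rpow_le hs hX hδ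
  obtain ⟨c, hc, hcδ⟩ := ENNReal.exists_pos_sum_of_countable' hδ.ne' ℕ
  let b : ℕ → ℝ≥0∞ := fun i => ediam (t i) ^ s + c i
  have hbsum : ∑' i, b i ≤ δ + δ := by
    rw [ENNReal.tsum_add]
    exact add_le_add ht hcδ.le
  have hδ1 : δ + δ ≤ 1 :=
    (add_le_add (min_le_right _ _) (min_le_right _ _)).trans (ENNReal.add_halves 1).le
  have hδε : 2 * (δ + δ) ≤ ε := by
    calc 2 * (δ + δ) = 4 * δ := by ring
      _ ≤ 4 * (ε / 4) := by gcongr; exact min_le_left _ _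
      _ ≤ ε := ENNReal.mul_div_le
  have hb1 : ∀ i, b i ≤ 1 := fun i => (ENNReal.le_tsum i).trans (hbsum.trans hδ1)
  have ha : ∀ i, ∃ a : ℝ≥0, 0 < a ∧ a ≤ 1 ∧ ediam (t i) ≤ a ∧ (a : ℝ≥0∞) ^ s = b i := by
    intro i
    have h1 : b i ^ s⁻¹ ≤ 1 := ENNReal.rpow_le_one (hb1 i) (inv_nonneg.2 hs.le)
    have hpos : 0 < b i ^ s⁻¹ :=
      ENNReal.rpow_pos ((hc i).trans_le le_add_self) ((hb1 i).trans_lt ENNReal.one_lt_top).ne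
    lift b i ^ s⁻¹ to ℝ≥0 using (h1.trans_lt ENNReal.one_lt_top).ne with a ha
    refine ⟨a, by exact_mod_cast hpos, by exact_mod_cast h1, ?_, ?_⟩
    · rw [ha, ENNReal.le_rpow_inv_iff hs]
      exact le_self_add
    · rw [ha, ENNReal.rpow_inv_rpow hs.ne']
  choose a ha0 ha1 hta hab using ha
  choose N u hu hua hN using fun i => exists_cover_prod_unitInterval (ha0 i) (ha1 i) (hta i)
  refine ⟨Σ i, Fin (N i), inferInstance, fun p => u p.1 p.2, ?_, ?_⟩
  · intro z _
    obtain ⟨i, hi⟩ := mem_iUnion.1 (hXt (mem_univ z.1))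
    obtain ⟨k, hk⟩ := mem_iUnion.1 (hu i ⟨hi, mem_univ z.2⟩)
    exact mem_iUnion.2 ⟨⟨i, k⟩, hk⟩
  · refine (ENNReal.tsum_sigma fun i (k : Fin (N i)) => ediam (u i k) ^ (s + 1)).trans_le ?_
    refine le_trans (ENNReal.tsum_le_tsum fun i => ?_)
      ((ENNReal.tsum_mul_left (a := 2) (f := b)).le.trans (le_trans (by gcongr) hδε))
    calc ∑' k : Fin (N i), ediam (u i k) ^ (s + 1)
        ≤ ∑' _ : Fin (N i), (a i : ℝ≥0∞) ^ (s + 1) := by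
          refine ENNReal.tsum_le_tsum fun k => ?_
          exact ENNReal.rpow_le_rpow (hua i k) (by linarith)
      _ = (N i * a i) * (a i : ℝ≥0∞) ^ s := by
          rw [tsum_fintype, Finset.sum_const, Finset.card_univ, Fintype.card_fin, nsmul_eq_mul,
            ENNReal.rpow_add_of_nonneg _ _ hs.le zero_le_one, ENNReal.rpow_one]
          ring
      _ ≤ 2 * b i := by
          rw [hab i]
          gcongr
          exact hN i

end HausdorffNull

theorem hdim_of_nonempty {X : Type*} [EMetricSpace X] {s : Set X} (hs : s.Nonempty) :
    hdim s = (dimH s : EReal) := if_neg hs.ne_empty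

theorem hdim_le_dimH {X : Type*} [EMetricSpace X] (s : Set X) : hdim s ≤ (dimH s : EReal) := by
  rcases s.eq_empty_or_nonempty with rfl | hs
  · rw [hdim, if_pos rfl]
    exact (EReal.neg_le_zero.2 zero_le_one).trans (EReal.coe_ennreal_nonneg _)
  · exact (hdim_of_nonempty hs).le

open scoped ENNReal NNReal in
/-- The product with the unit interval has arbitrarily small balls around any point whose
frontiers have dimension at most that of the first factor. -/
theorem exists_ball_dimH_frontier_le {X : Type*} [MetricSpace X]
    [TopologicalSpace.SeparableSpace X] (z : X × ↥(Set.Icc (0 : ℝ) 1)) {ε : ℝ} (hε : 0 < ε) :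
    ∃ r, 0 < r ∧ r < ε ∧ dimH (frontier (ball z r)) ≤ dimH (univ : Set X) := by
  have : SecondCountableTopology X := UniformSpace.secondCountable_of_separable X
  borelize X
  by_cases hX : dimH (univ : Set X) = ⊤
  · exact ⟨ε / 2, by linarith, by linarith, hX ▸ le_top⟩
  obtain ⟨s, -, hs, hslim⟩ := exists_seq_strictAnti_tendsto' (lt_top_iff_ne_top.2 hX)
  have hae : ∀ n, ∀ᵐ r : ℝ, dimH (sphere z r) ≤ s n := by
    intro n
    have hst : s n ≠ ⊤ := (hs n).2.ne
    have hs0 : 0 < s n := zero_le.trans_lt (hs n).1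
    lift s n to ℝ≥0 using hst with p hp
    have h0 : μH[(p : ℝ)] (univ : Set X) = 0 :=
      hausdorffMeasure_of_dimH_lt (hp ▸ (hs n).1)
    have hp0 : 0 < (p : ℝ) := by exact_mod_cast hs0
    filter_upwards [ae_hausdorffMeasure_preimage_singleton_eq_zero hp0
      (hausdorffMeasure_prod_unitInterval_eq_zero hp0 h0) (LipschitzWith.dist_left z)] with r hr
    exact dimH_le_of_hausdorffMeasure_ne_top (by
      rw [show sphere z r = (fun y => dist y z) ⁻¹' {r} from rfl, hr]; simp)
  have hne : ∃ r ∈ Ioo 0 ε, ∀ n, dimH (sphere z r) ≤ s n := by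
    by_contra! hcon
    have hsub : Ioo 0 ε ⊆ {r : ℝ | ∀ n, dimH (sphere z r) ≤ s n}ᶜ := fun r hr hall => by
      obtain ⟨n, hn⟩ := hcon r hr
      exact absurd (hall n) hn.not_ge
    have hnull : volume (Ioo 0 ε) = 0 := measure_mono_null hsub (ae_all_iff.2 hae)
    simp only [Real.volume_Ioo, ENNReal.ofReal_eq_zero] at hnull
    linarith
  obtain ⟨r, hr, hall⟩ := hne
  exact ⟨r, hr.1, hr.2, (dimH_mono frontier_ball_subset_sphere).trans
    (ge_of_tendsto' hslim hall)⟩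

/-- If the frontiers of the members of a basis of `X × [0,1]` have dimension at most `c`, then so
has `X`. -/
theorem coe_dimH_le_of_isTopologicalBasis {X : Type*} [MetricSpace X] [Nonempty X]
    [TopologicalSpace.SeparableSpace X] {𝒰 : Set (Set (X × ↥(Set.Icc (0 : ℝ) 1)))}
    (h𝒰 : TopologicalSpace.IsTopologicalBasis 𝒰) {c : EReal}
    (hc : ∀ U ∈ 𝒰, hdim (frontier U) ≤ c) : (dimH (univ : Set X) : EReal) ≤ c := by
  have : SecondCountableTopology X := UniformSpace.secondCountable_of_separable X
  have hloc : ∀ x : X, ∃ B ∈ 𝓝 x, (dimH B : EReal) ≤ c := by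
    intro x
    obtain ⟨U, hU, hxU, hU1⟩ := h𝒰.exists_subset_of_mem_open
      (a := (x, (0 : ↥(Set.Icc (0 : ℝ) 1)))) (u := {z | z.2 ≠ 1}) (by simp)
      (isOpen_ne_fun continuous_snd continuous_const)
    let B : Set X := (fun y => (y, (0 : ↥(Set.Icc (0 : ℝ) 1)))) ⁻¹' U
    have hB : B ∈ 𝓝 x :=
      ((h𝒰.isOpen hU).preimage (Continuous.prodMk_left 0)).mem_nhds hxU
    have hsub : B ⊆ Prod.fst '' frontier U := by
      intro y hy
      let γ : ↥(Set.Icc (0 : ℝ) 1) → X × ↥(Set.Icc (0 : ℝ) 1) := fun t => (y, t)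
      have hγ : Continuous γ := Continuous.prodMk_right y
      obtain ⟨t, ht⟩ : (frontier (γ ⁻¹' U)).Nonempty := by
        refine nonempty_frontier_iff.2 ⟨⟨0, hy⟩, fun h => ?_⟩
        have h1 : (1 : ↥(Set.Icc (0 : ℝ) 1)) ∈ γ ⁻¹' U := h ▸ mem_univ _
        exact hU1 h1 rfl
      exact ⟨γ t, hγ.frontier_preimage_subset U ht, rfl⟩
    refine ⟨B, hB, ?_⟩
    have hne : (frontier U).Nonempty := (Set.Nonempty.mono hsub ⟨x, hxU⟩).of_image
    calc (dimH B : EReal) ≤ (dimH (frontier U) : EReal) :=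
          EReal.coe_ennreal_le_coe_ennreal_iff.2
            ((dimH_mono hsub).trans (LipschitzWith.prod_fst.dimH_image_le _))
      _ = hdim (frontier U) := (hdim_of_nonempty hne).symm
      _ ≤ c := hc U hU
  choose B hB hBc using hloc
  obtain ⟨S, hS, hSB⟩ := TopologicalSpace.countable_cover_nhds hB
  have hc0 : 0 ≤ c := (EReal.coe_ennreal_nonneg _).trans (hBc (Classical.arbitrary X))
  rw [← EReal.coe_toENNReal hc0, EReal.coe_ennreal_le_coe_ennreal_iff, ← hSB, dimH_bUnion hS]
  refine iSup₂_le fun x _ => ?_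
  rw [← EReal.coe_ennreal_le_coe_ennreal_iff, EReal.coe_toENNReal hc0]
  exact hBc x

/-- If `X` is a nonempty separable metric space then
`dim_tH (X × [0,1]) = dim_H X + 1`. -/
theorem tHdim_prod_unitInterval
    {X : Type*} [MetricSpace X] [Nonempty X] [TopologicalSpace.SeparableSpace X] :
    tHdim (X × ↥(Set.Icc (0 : ℝ) 1)) = hdim (Set.univ : Set X) + 1 := by
  rw [tHdim, if_pos (inferInstance : Nonempty (X × ↥(Set.Icc (0 : ℝ) 1))), hdim_of_nonempty univ_nonempty]
  apply le_antisymm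
  · refine sInf_le ⟨{U | ∃ z r, 0 < r ∧ U = ball z r ∧
      dimH (frontier U) ≤ dimH (univ : Set X)}, ?_, ?_⟩
    · refine TopologicalSpace.isTopologicalBasis_of_isOpen_of_nhds ?_ ?_
      · rintro _ ⟨z, r, -, rfl, -⟩
        exact isOpen_ball
      · intro z V hz hV
        obtain ⟨ε, hε, hεV⟩ := Metric.isOpen_iff.1 hV z hz
        obtain ⟨r, hr, hrε, hfr⟩ := exists_ball_dimH_frontier_le z hε
        exact ⟨ball z r, ⟨z, r, hr, rfl, hfr⟩, mem_ball_self hr,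
          (ball_subset_ball hrε.le).trans hεV⟩
    · rintro U ⟨z, r, -, -, hU⟩
      have h1 : (dimH (univ : Set X) : EReal) + 1 - 1 = dimH (univ : Set X) :=
        EReal.add_sub_cancel_right (b := 1)
      rw [h1]
      exact (hdim_le_dimH _).trans (EReal.coe_ennreal_le_coe_ennreal_iff.2 hU)
  · refine le_sInf ?_
    rintro d ⟨𝒰, h𝒰, hd⟩
    exact EReal.add_le_of_le_sub (coe_dimH_le_of_isTopologicalBasis h𝒰 hd)
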